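/- arXiv:1005.5023 — 7 statements merged into one kernel-verified Lean document; each statement's English description precedes it below -/
import Mathlib

section
/- Let d ≥ 1, t > 0, let S:(0,∞)→[0,∞) be measurable, and let μ be a probability measure on (0,∞) satisfying ∫_{(0,∞)} e^{−λs} μ(ds) = e^{−t S(λ)} for every λ > 0. Let P_s be the heat semigroup on ℝ^d and define the subordinate operator P^S f(x) := ∫_{(0,∞)} P_s f(x) μ(ds) for bounded measurable f:ℝ^d→ℝ. Then for all x, y ∈ ℝ^d: |P^S f(x) − P^S f(y)| ≤ ‖f‖_∞ · (2π)^{−1/2} · (∫_0^∞ r^{−1/2} e^{−t S(r)} dr) · |x − y|. -/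
open MeasureTheory

/-- The heat semigroup on `ℝ^d`: `P_s f (x) = (4πs)^{-d/2} ∫ e^{-|x-y|²/(4s)} f(y) dy`. -/
noncomputable def heatSemigroup (d : ℕ) (s : ℝ)
    (f : EuclideanSpace ℝ (Fin d) → ℝ) (x : EuclideanSpace ℝ (Fin d)) : ℝ :=
  (4 * Real.pi * s) ^ (-(d : ℝ) / 2) * ∫ y, Real.exp (-‖x - y‖ ^ 2 / (4 * s)) * f y

section Gaussian

variable {d : ℕ} {s : ℝ}

theorem integrable_exp_neg_sq_norm_sub (hs : 0 < s) (x : EuclideanSpace ℝ (Fin d)) :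
    Integrable fun z => Real.exp (-‖x - z‖ ^ 2 / (4 * s)) := by
  have h : Integrable fun z : EuclideanSpace ℝ (Fin d) =>
      Real.exp (-(1 / (4 * s)) * ‖z‖ ^ 2) := by
    have hb : (0 : ℝ) < ((1 / (4 * s) : ℝ) : ℂ).re := by
      rw [Complex.ofReal_re]; positivity
    have := (GaussianFourier.integrable_cexp_neg_mul_sq_norm_add (V := EuclideanSpace ℝ (Fin d))
      hb 0 0).norm
    refine this.congr (Filter.Eventually.of_forall fun z => ?_)
    simp only [Complex.norm_exp]
    congr 1
    simp [← Complex.ofReal_pow, ← Complex.ofReal_mul]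
  refine (h.comp_sub_left x).congr (Filter.Eventually.of_forall fun z => ?_)
  simp only
  congr 1
  ring

theorem integral_exp_neg_sq_norm_sub (hs : 0 < s) (x : EuclideanSpace ℝ (Fin d)) :
    ∫ z, Real.exp (-‖x - z‖ ^ 2 / (4 * s)) = (4 * Real.pi * s) ^ ((d : ℝ) / 2) := by
  have h := GaussianFourier.integral_rexp_neg_mul_sq_norm (V := EuclideanSpace ℝ (Fin d))
    (b := 1 / (4 * s)) (by positivity)
  rw [finrank_euclideanSpace_fin] at h
  rw [← integral_sub_left_eq_self _ volume x] at h
  rw [show 4 * Real.pi * s = Real.pi / (1 / (4 * s)) by field_simp, ← h]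
  congr 1 with z
  congr 1
  ring

theorem heatKernel_mass (hs : 0 < s) (x : EuclideanSpace ℝ (Fin d)) :
    (4 * Real.pi * s) ^ (-(d : ℝ) / 2) * ∫ z, Real.exp (-‖x - z‖ ^ 2 / (4 * s)) = 1 := by
  have hp : 0 < 4 * Real.pi * s := by positivity
  rw [integral_exp_neg_sq_norm_sub hs, ← Real.rpow_add hp]
  simp [neg_div]

/-- The product of the square roots of two Gaussians is a Gaussian centred at the midpoint. -/
theorem exp_neg_sq_norm_sub_mul (x y z : EuclideanSpace ℝ (Fin d)) :
    Real.exp (-‖x - z‖ ^ 2 / (8 * s)) * Real.exp (-‖y - z‖ ^ 2 / (8 * s)) =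
      Real.exp (-(‖x - y‖ ^ 2 / (16 * s))) *
        Real.exp (-‖(1 / 2 : ℝ) • (x + y) - z‖ ^ 2 / (4 * s)) := by
  have h := parallelogram_law_with_norm ℝ (x - z) (y - z)
  have h1 : (x - z) + (y - z) = (2 : ℝ) • ((1 / 2 : ℝ) • (x + y) - z) := by module
  have h2 : (x - z) - (y - z) = x - y := by module
  rw [h1, h2, norm_smul, Real.norm_ofNat] at h
  rw [← Real.exp_add, ← Real.exp_add]
  congr 1
  have h3 : ‖x - z‖ ^ 2 + ‖y - z‖ ^ 2 =
      2 * ‖(1 / 2 : ℝ) • (x + y) - z‖ ^ 2 + ‖x - y‖ ^ 2 / 2 := by linarith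
  rw [← add_div, show -‖x - z‖ ^ 2 + -‖y - z‖ ^ 2 =
    -(2 * ‖(1 / 2 : ℝ) • (x + y) - z‖ ^ 2 + ‖x - y‖ ^ 2 / 2) by linarith]
  rcases eq_or_ne s 0 with rfl | hs
  · simp
  · field_simp
    ring

/-- The `L¹` distance of two translates of the heat kernel, bounded through the Hellinger
affinity. -/
theorem heatKernel_integral_abs_sub_le (hs : 0 < s) (x y : EuclideanSpace ℝ (Fin d)) :
    (4 * Real.pi * s) ^ (-(d : ℝ) / 2) *
      ∫ z, |Real.exp (-‖x - z‖ ^ 2 / (4 * s)) - Real.exp (-‖y - z‖ ^ 2 / (4 * s))| ≤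
        ‖x - y‖ * (2 * s) ^ (-(1 : ℝ) / 2) := by
  rcases eq_or_ne x y with rfl | hxy
  · simp
  have hδ : 0 < ‖x - y‖ := norm_pos_iff.2 (sub_ne_zero.2 hxy)
  set δ := ‖x - y‖
  set C := (4 * Real.pi * s) ^ (-(d : ℝ) / 2)
  have hC0 : 0 ≤ C := by positivity
  set w := √(2 * s)
  have hw0 : 0 < w := by positivity
  have hw2 : w ^ 2 = 2 * s := Real.sq_sqrt (by positivity)
  have hrp : (2 * s) ^ (-(1 : ℝ) / 2) = w⁻¹ := by
    rw [neg_div, Real.rpow_neg (by positivity), ← Real.sqrt_eq_rpow]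
  set a := 4 * w / δ with ha
  have ha0 : 0 < a := by positivity
  set B := Real.exp (-(δ ^ 2 / (16 * s)))
  set m := (1 / 2 : ℝ) • (x + y)
  let G : EuclideanSpace ℝ (Fin d) → EuclideanSpace ℝ (Fin d) → ℝ :=
    fun c z => Real.exp (-‖c - z‖ ^ 2 / (4 * s))
  have hG : ∀ c, Integrable (G c) := integrable_exp_neg_sq_norm_sub hs
  have hpt : ∀ z, |G x z - G y z| ≤
      (a + a⁻¹) / 2 * G x z + (a + a⁻¹) / 2 * G y z + (a⁻¹ - a) * B * G m z := by
    intro z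
    have hsq : ∀ c, G c z = Real.exp (-‖c - z‖ ^ 2 / (8 * s)) ^ 2 := by
      intro c
      rw [← Real.exp_nat_mul]
      simp only [G]
      congr 1
      push_cast
      field_simp
      ring
    have hmul : B * G m z =
      Real.exp (-‖x - z‖ ^ 2 / (8 * s)) * Real.exp (-‖y - z‖ ^ 2 / (8 * s)) :=
      (exp_neg_sq_norm_sub_mul x y z).symm
    rw [mul_assoc, hmul, hsq x, hsq y]
    generalize Real.exp (-‖x - z‖ ^ 2 / (8 * s)) = g
    generalize Real.exp (-‖y - z‖ ^ 2 / (8 * s)) = h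
    have haa : a * a⁻¹ = 1 := mul_inv_cancel₀ ha0.ne'
    have hi : 0 < a⁻¹ := by positivity
    have e1 : 0 ≤ a⁻¹ * (a * (g - h) - (g + h)) ^ 2 := by positivity
    have e2 : 0 ≤ a⁻¹ * (a * (g - h) + (g + h)) ^ 2 := by positivity
    have f1 : a⁻¹ * (a * (g - h) - (g + h)) ^ 2 =
        a * (g - h) ^ 2 - 2 * (g - h) * (g + h) + a⁻¹ * (g + h) ^ 2 := by
      field_simp
      ring
    have f2 : a⁻¹ * (a * (g - h) + (g + h)) ^ 2 =
        a * (g - h) ^ 2 + 2 * (g - h) * (g + h) + a⁻¹ * (g + h) ^ 2 := by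
      field_simp
      ring
    rw [abs_le]
    constructor <;> nlinarith
  have hint : ∫ z, |G x z - G y z| ≤ (a + a⁻¹) / 2 * (∫ z, G x z) +
      (a + a⁻¹) / 2 * (∫ z, G y z) + (a⁻¹ - a) * B * ∫ z, G m z := by
    have i1 := (hG x).const_mul ((a + a⁻¹) / 2)
    have i2 := (hG y).const_mul ((a + a⁻¹) / 2)
    have i3 := (hG m).const_mul ((a⁻¹ - a) * B)
    calc ∫ z, |G x z - G y z| ≤ _ :=
          integral_mono ((hG x).sub (hG y)).abs ((i1.add i2).add i3) hpt
      _ = _ := by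
          rw [integral_add' (i1.add i2) i3, integral_add' i1 i2]
          simp only [integral_const_mul]
  have hmass : ∀ c, C * ∫ z, G c z = 1 := heatKernel_mass hs
  have hB1 : 1 - δ ^ 2 / (16 * s) ≤ B := by
    have := Real.add_one_le_exp (-(δ ^ 2 / (16 * s)))
    linarith
  have hB2 : B ≤ 1 := Real.exp_le_one_iff.2 (by
    have : 0 ≤ δ ^ 2 / (16 * s) := by positivity
    linarith)
  calc C * ∫ z, |G x z - G y z| ≤ C * ((a + a⁻¹) / 2 * (∫ z, G x z) +
      (a + a⁻¹) / 2 * (∫ z, G y z) + (a⁻¹ - a) * B * ∫ z, G m z) :=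
        mul_le_mul_of_nonneg_left hint hC0
    _ = (a + a⁻¹) / 2 * (C * ∫ z, G x z) + (a + a⁻¹) / 2 * (C * ∫ z, G y z) +
        (a⁻¹ - a) * B * (C * ∫ z, G m z) := by ring
    _ = a * (1 - B) + a⁻¹ * (1 + B) := by rw [hmass, hmass, hmass]; ring
    _ ≤ a * (δ ^ 2 / (16 * s)) + a⁻¹ * 2 := by gcongr <;> linarith
    _ = δ * (2 * s) ^ (-(1 : ℝ) / 2) := by
        rw [hrp, ha, show s = w ^ 2 / 2 by linarith]
        field_simp
        norm_num

end Gaussian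

section HeatSemigroup

variable {d : ℕ} {s : ℝ} {f : EuclideanSpace ℝ (Fin d) → ℝ} {M : ℝ}

theorem integrable_heatKernel_mul (hs : 0 < s) (hf : Measurable f) (hM : ∀ x, |f x| ≤ M)
    (x : EuclideanSpace ℝ (Fin d)) :
    Integrable fun z => Real.exp (-‖x - z‖ ^ 2 / (4 * s)) * f z :=
  (integrable_exp_neg_sq_norm_sub hs x).mul_bdd hf.aestronglyMeasurable
    (Filter.Eventually.of_forall hM)

theorem abs_heatSemigroup_le (hs : 0 < s) (hM : ∀ x, |f x| ≤ M)
    (x : EuclideanSpace ℝ (Fin d)) : |heatSemigroup d s f x| ≤ M := by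
  have hC : 0 ≤ (4 * Real.pi * s) ^ (-(d : ℝ) / 2) := by positivity
  have h : |∫ z, Real.exp (-‖x - z‖ ^ 2 / (4 * s)) * f z| ≤
      ∫ z, Real.exp (-‖x - z‖ ^ 2 / (4 * s)) * M := by
    rw [← Real.norm_eq_abs]
    refine norm_integral_le_of_norm_le ((integrable_exp_neg_sq_norm_sub hs x).mul_const M)
      (Filter.Eventually.of_forall fun z => ?_)
    rw [norm_mul, Real.norm_eq_abs, Real.abs_exp]
    exact mul_le_mul_of_nonneg_left (hM z) (Real.exp_pos _).le
  rw [heatSemigroup, abs_mul, abs_of_nonneg hC]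
  refine (mul_le_mul_of_nonneg_left h hC).trans_eq ?_
  rw [integral_mul_const, ← mul_assoc, heatKernel_mass hs, one_mul]

theorem abs_heatSemigroup_sub_le (hs : 0 < s) (hf : Measurable f) (hM : ∀ x, |f x| ≤ M)
    (x y : EuclideanSpace ℝ (Fin d)) :
    |heatSemigroup d s f x - heatSemigroup d s f y| ≤
      M * (‖x - y‖ * (2 * s) ^ (-(1 : ℝ) / 2)) := by
  have hC : 0 ≤ (4 * Real.pi * s) ^ (-(d : ℝ) / 2) := by positivity
  have hM0 : 0 ≤ M := (abs_nonneg _).trans (hM x)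
  have h : |∫ z, (Real.exp (-‖x - z‖ ^ 2 / (4 * s)) * f z -
        Real.exp (-‖y - z‖ ^ 2 / (4 * s)) * f z)| ≤
      ∫ z, |Real.exp (-‖x - z‖ ^ 2 / (4 * s)) - Real.exp (-‖y - z‖ ^ 2 / (4 * s))| * M := by
    rw [← Real.norm_eq_abs]
    refine norm_integral_le_of_norm_le (((integrable_exp_neg_sq_norm_sub hs x).sub
      (integrable_exp_neg_sq_norm_sub hs y)).abs.mul_const M)
      (Filter.Eventually.of_forall fun z => ?_)
    rw [← sub_mul, norm_mul]
    exact mul_le_mul_of_nonneg_left (hM z) (abs_nonneg _)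
  rw [heatSemigroup, heatSemigroup, ← mul_sub, ← integral_sub
    (integrable_heatKernel_mul hs hf hM x) (integrable_heatKernel_mul hs hf hM y),
    abs_mul, abs_of_nonneg hC]
  refine (mul_le_mul_of_nonneg_left h hC).trans ?_
  rw [integral_mul_const, ← mul_assoc, mul_comm _ M]
  exact mul_le_mul_of_nonneg_left (heatKernel_integral_abs_sub_le hs x y) hM0

theorem measurable_heatSemigroup (hf : Measurable f) (x : EuclideanSpace ℝ (Fin d)) :
    Measurable fun s => heatSemigroup d s f x := by
  have h : StronglyMeasurable fun p : ℝ × EuclideanSpace ℝ (Fin d) =>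
      Real.exp (-‖x - p.2‖ ^ 2 / (4 * p.1)) * f p.2 := by
    refine Measurable.stronglyMeasurable ?_
    fun_prop
  have h2 := (h.integral_prod_right' (ν := volume)).measurable
  unfold heatSemigroup
  exact Measurable.mul (by fun_prop) h2

theorem integrableOn_heatSemigroup (μ : Measure ℝ) [IsFiniteMeasure μ] (hf : Measurable f)
    (hM : ∀ x, |f x| ≤ M) (x : EuclideanSpace ℝ (Fin d)) :
    IntegrableOn (fun s => heatSemigroup d s f x) (Set.Ioi 0) μ := by
  refine Integrable.of_bound (measurable_heatSemigroup hf x).aestronglyMeasurable M ?_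
  filter_upwards [ae_restrict_mem measurableSet_Ioi] with s hs
  exact abs_heatSemigroup_le hs hM x

end HeatSemigroup

theorem integral_rpow_neg_half_mul_exp {s : ℝ} (hs : 0 < s) :
    ∫ r in Set.Ioi (0 : ℝ), r ^ (-(1 : ℝ) / 2) * Real.exp (-(r * s)) =
      √Real.pi * s ^ (-(1 : ℝ) / 2) := by
  have h := Real.integral_rpow_mul_exp_neg_mul_Ioi (a := 1 / 2) (by norm_num) hs
  rw [Real.Gamma_one_half_eq, one_div s, Real.inv_rpow hs.le, ← Real.rpow_neg hs.le] at h
  rw [neg_div, mul_comm (√Real.pi), ← h]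
  congr 1 with r
  rw [mul_comm r s]
  norm_num

/-- The moment of order `-1/2` of a measure in terms of its Laplace transform `φ`. -/
theorem integral_rpow_neg_half_of_laplace (μ : Measure ℝ) [IsFiniteMeasure μ] {φ : ℝ → ℝ}
    (hφ : ∀ l ∈ Set.Ioi (0 : ℝ), ∫ s in Set.Ioi (0 : ℝ), Real.exp (-(l * s)) ∂μ = φ l)
    (hint : IntegrableOn (fun r => r ^ (-(1 : ℝ) / 2) * φ r) (Set.Ioi 0)) :
    IntegrableOn (fun s => √Real.pi * s ^ (-(1 : ℝ) / 2)) (Set.Ioi 0) μ ∧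
      ∫ s in Set.Ioi (0 : ℝ), √Real.pi * s ^ (-(1 : ℝ) / 2) ∂μ =
        ∫ r in Set.Ioi (0 : ℝ), r ^ (-(1 : ℝ) / 2) * φ r := by
  let F : ℝ × ℝ → ℝ := fun p => p.2 ^ (-(1 : ℝ) / 2) * Real.exp (-(p.2 * p.1))
  have hF : Measurable F := by fun_prop
  have hFr : ∀ r ∈ Set.Ioi (0 : ℝ),
      ∫ s in Set.Ioi (0 : ℝ), F (s, r) ∂μ = r ^ (-(1 : ℝ) / 2) * φ r := by
    intro r hr
    simp only [F]
    rw [integral_const_mul, hφ r hr]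
  have hI : Integrable F
      ((μ.restrict (Set.Ioi 0)).prod (volume.restrict (Set.Ioi (0 : ℝ)))) := by
    rw [integrable_prod_iff' hF.aestronglyMeasurable]
    constructor
    · filter_upwards [ae_restrict_mem measurableSet_Ioi] with r hr
      have hm : Measurable fun s => Real.exp (-(r * s)) := by fun_prop
      have hb : Integrable (fun s => Real.exp (-(r * s))) (μ.restrict (Set.Ioi 0)) := by
        refine Integrable.of_bound hm.aestronglyMeasurable 1 ?_
        filter_upwards [ae_restrict_mem measurableSet_Ioi] with s hs
        rw [Real.norm_eq_abs, Real.abs_exp, Real.exp_le_one_iff]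
        have : 0 < r * s := mul_pos hr hs
        linarith
      exact hb.const_mul (r ^ (-(1 : ℝ) / 2))
    · refine hint.congr ?_
      filter_upwards [ae_restrict_mem measurableSet_Ioi] with r hr
      rw [← hFr r hr]
      congr 1 with s
      have : (0 : ℝ) < r := hr
      exact (Real.norm_of_nonneg (by positivity)).symm
  have hFs : (fun s => ∫ r in Set.Ioi (0 : ℝ), F (s, r)) =ᵐ[μ.restrict (Set.Ioi 0)]
      fun s => √Real.pi * s ^ (-(1 : ℝ) / 2) := by
    filter_upwards [ae_restrict_mem measurableSet_Ioi] with s hs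
    exact integral_rpow_neg_half_mul_exp hs
  refine ⟨hI.integral_prod_left.congr hFs, ?_⟩
  rw [← integral_congr_ae hFs, integral_integral_swap hI]
  exact setIntegral_congr_fun measurableSet_Ioi hFr

/-- Gradient (Lipschitz) estimate for the subordinate heat semigroup
`P^S f = ∫ P_s f μ_t^S(ds)`:
`|P^S f(x) - P^S f(y)| ≤ ‖f‖_∞ (2π)^{-1/2} (∫_0^∞ r^{-1/2} e^{-tS(r)} dr) |x - y|`. -/
theorem subordinate_heatSemigroup_lipschitz
    (d : ℕ) (hd : 1 ≤ d) (t : ℝ) (ht : 0 < t)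
    (S : ℝ → ℝ) (hSmeas : Measurable S) (hSnonneg : ∀ r ∈ Set.Ioi (0 : ℝ), 0 ≤ S r)
    (μ : Measure ℝ) [IsProbabilityMeasure μ] (hμ0 : μ (Set.Iic 0) = 0)
    (hLaplace : ∀ l ∈ Set.Ioi (0 : ℝ),
      ∫ s in Set.Ioi (0 : ℝ), Real.exp (-(l * s)) ∂μ = Real.exp (-(t * S l)))
    (hA : IntegrableOn (fun r => r ^ (-(1 : ℝ) / 2) * Real.exp (-(t * S r)))
      (Set.Ioi 0) volume)
    (f : EuclideanSpace ℝ (Fin d) → ℝ) (hf : Measurable f)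
    (M : ℝ) (hM : ∀ x, |f x| ≤ M)
    (x y : EuclideanSpace ℝ (Fin d)) :
    |(∫ s in Set.Ioi (0 : ℝ), heatSemigroup d s f x ∂μ)
        - ∫ s in Set.Ioi (0 : ℝ), heatSemigroup d s f y ∂μ|
      ≤ M * (2 * Real.pi) ^ (-(1 : ℝ) / 2)
          * (∫ r in Set.Ioi (0 : ℝ), r ^ (-(1 : ℝ) / 2) * Real.exp (-(t * S r)))
          * ‖x - y‖ := by
  obtain ⟨hint, heq⟩ := integral_rpow_neg_half_of_laplace μ hLaplace hA
  have hc : ∀ s ∈ Set.Ioi (0 : ℝ), M * (‖x - y‖ * (2 * s) ^ (-(1 : ℝ) / 2)) =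
      M * (2 * Real.pi) ^ (-(1 : ℝ) / 2) * ‖x - y‖ * (√Real.pi * s ^ (-(1 : ℝ) / 2)) := by
    intro s hs
    have hπ : Real.pi ^ (-(1 : ℝ) / 2) * √Real.pi = 1 := by
      rw [Real.sqrt_eq_rpow, ← Real.rpow_add Real.pi_pos]
      norm_num
    rw [Real.mul_rpow (by norm_num) (le_of_lt hs), Real.mul_rpow (by norm_num) Real.pi_pos.le]
    linear_combination (-(M * ‖x - y‖ * (2 : ℝ) ^ (-(1 : ℝ) / 2) * s ^ (-(1 : ℝ) / 2))) * hπ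
  rw [← integral_sub (integrableOn_heatSemigroup μ hf hM x) (integrableOn_heatSemigroup μ hf hM y)]
  have hle : |∫ s in Set.Ioi (0 : ℝ), (heatSemigroup d s f x - heatSemigroup d s f y) ∂μ| ≤
      ∫ s in Set.Ioi (0 : ℝ), M * (2 * Real.pi) ^ (-(1 : ℝ) / 2) * ‖x - y‖ *
        (√Real.pi * s ^ (-(1 : ℝ) / 2)) ∂μ := by
    rw [← Real.norm_eq_abs]
    refine norm_integral_le_of_norm_le (hint.const_mul _) ?_
    filter_upwards [ae_restrict_mem measurableSet_Ioi] with s hs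
    rw [← hc s hs]
    exact abs_heatSemigroup_sub_le hs hf hM x y
  refine hle.trans_eq ?_
  rw [integral_const_mul, heq]
  ring
end

section
/- Let d ≥ 1 and let f₀:ℝ^d→ℝ be defined by f₀(x) = 1 if x₁ ≥ 0 and f₀(x) = −1 if x₁ < 0. Let μ be a probability measure on (0,∞) with ∫_{(0,∞)} s^{−1/2} μ(ds) < ∞, and define G(x) := ∫_{(0,∞)} P_s f₀(x) μ(ds), where P_s is the heat semigroup on ℝ^d. Then G is differentiable in the first coordinate at 0 with ∂_{x₁} G(0) = π^{−1/2} ∫_{(0,∞)} s^{−1/2} μ(ds). -/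
open MeasureTheory

open Set in
theorem integral_gaussian_sub_mul_sign {b : ℝ} (hb : 0 < b) (τ : ℝ) :
    ∫ u : ℝ, Real.exp (-b * (τ - u) ^ 2) * (if 0 ≤ u then (1 : ℝ) else -1) =
      2 * ∫ v in (0 : ℝ)..τ, Real.exp (-b * v ^ 2) := by
  set g : ℝ → ℝ := fun v => Real.exp (-b * v ^ 2)
  have hgi : Integrable g := integrable_exp_neg_mul_sq hb
  have htotal : ∫ v, g v = √(Real.pi / b) := integral_gaussian b
  have hIoi : ∫ v in Ioi (0 : ℝ), g v = √(Real.pi / b) / 2 := integral_gaussian_Ioi b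
  have hsplit (a : ℝ) : (∫ v in Iic a, g v) + ∫ v in Ioi a, g v = √(Real.pi / b) := by
    rw [← htotal, ← compl_Iic]
    exact integral_add_compl measurableSet_Iic hgi
  have hsub := intervalIntegral.integral_Iic_sub_Iic (μ := volume) (a := 0) (b := τ)
    hgi.integrableOn hgi.integrableOn
  have hflip : ∫ u : ℝ, g (τ - u) * (if 0 ≤ u then (1 : ℝ) else -1) =
      ∫ w : ℝ, g w * (if w ≤ τ then (1 : ℝ) else -1) := by
    rw [← integral_sub_left_eq_self _ volume τ]
    simp [sub_nonneg]
  have hind : (fun w : ℝ => g w * (if w ≤ τ then (1 : ℝ) else -1)) =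
      fun w => (Iic τ).indicator g w - (Ioi τ).indicator g w := by
    ext w
    by_cases h : w ≤ τ
    · simp [h]
    · simp [h, not_le.mp h]
  change ∫ u : ℝ, g (τ - u) * (if 0 ≤ u then (1 : ℝ) else -1) = 2 * ∫ v in (0 : ℝ)..τ, g v
  rw [hflip, hind, integral_sub (hgi.indicator measurableSet_Iic) (hgi.indicator measurableSet_Ioi),
    integral_indicator measurableSet_Iic, integral_indicator measurableSet_Ioi]
  linarith [hsplit 0, hsplit τ]

theorem heatSemigroup_sign_smul_single (d : ℕ) (hd : 1 ≤ d) {s : ℝ} (hs : 0 < s) (τ : ℝ) :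
    heatSemigroup d s (fun x => if 0 ≤ x ⟨0, hd⟩ then (1 : ℝ) else -1)
        (τ • EuclideanSpace.single ⟨0, hd⟩ (1 : ℝ)) =
      Real.pi ^ (-(1 : ℝ) / 2) * s ^ (-(1 : ℝ) / 2) *
        ∫ v in (0 : ℝ)..τ, Real.exp (-(4 * s)⁻¹ * v ^ 2) := by
  obtain ⟨n, rfl⟩ : ∃ n, d = n + 1 := ⟨d - 1, by omega⟩
  have hb : 0 < (4 * s)⁻¹ := by positivity
  set b : ℝ := (4 * s)⁻¹ with hbdef
  let φ : Fin (n + 1) → ℝ → ℝ := Fin.cons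
    (fun u => Real.exp (-b * (τ - u) ^ 2) * (if 0 ≤ u then (1 : ℝ) else -1))
    (fun _ u => Real.exp (-b * u ^ 2))
  have hprod : (∫ y : EuclideanSpace ℝ (Fin (n + 1)),
      Real.exp (-‖τ • EuclideanSpace.single ⟨0, hd⟩ (1 : ℝ) - y‖ ^ 2 / (4 * s)) *
        (if 0 ≤ y ⟨0, hd⟩ then (1 : ℝ) else -1)) =
      ∫ y : Fin (n + 1) → ℝ, ∏ i, φ i (y i) := by
    rw [← (EuclideanSpace.volume_preserving_symm_measurableEquiv_toLp
      (Fin (n + 1))).symm.integral_comp']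
    refine integral_congr_ae (.of_forall fun y => ?_)
    have h0 : (⟨0, hd⟩ : Fin (n + 1)) = 0 := rfl
    simp only [EuclideanSpace.norm_sq_eq, Fin.prod_univ_succ, Fin.sum_univ_succ, φ, Fin.cons_zero,
      Fin.cons_succ, h0]
    rw [← Real.exp_sum, mul_right_comm, ← Real.exp_add]
    simp only [← Finset.mul_sum]
    congr 2
    simp [hbdef]
    ring
  have hsq : √(Real.pi / b) = (4 * Real.pi * s) ^ ((1 : ℝ) / 2) := by
    rw [Real.sqrt_eq_rpow, hbdef, div_inv_eq_mul]
    congr 1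
    ring
  have hpos : 0 < 4 * Real.pi * s := by positivity
  rw [heatSemigroup, hprod, integral_fintype_prod_volume_eq_prod, Fin.prod_univ_succ]
  simp only [φ, Fin.cons_zero, Fin.cons_succ]
  rw [integral_gaussian_sub_mul_sign hb]
  simp only [integral_gaussian, hsq, Finset.prod_const, Finset.card_univ, Fintype.card_fin]
  rw [← Real.rpow_natCast, ← Real.rpow_mul hpos.le]
  have hconst : (4 * Real.pi * s) ^ (-((n + 1 : ℕ) : ℝ) / 2) *
      (4 * Real.pi * s) ^ ((1 : ℝ) / 2 * n) * 2 =
      Real.pi ^ (-(1 : ℝ) / 2) * s ^ (-(1 : ℝ) / 2) := by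
    have h4 : (4 : ℝ) ^ (-(1 : ℝ) / 2) = 1 / 2 := by
      rw [show (4 : ℝ) = 2 ^ (2 : ℝ) by norm_num, ← Real.rpow_mul (by norm_num)]
      norm_num [Real.rpow_neg_one]
    rw [← Real.rpow_add hpos,
      show -((n + 1 : ℕ) : ℝ) / 2 + (1 : ℝ) / 2 * n = -(1 : ℝ) / 2 by push_cast; ring,
      Real.mul_rpow (by positivity) hs.le, Real.mul_rpow (by norm_num) Real.pi_pos.le, h4]
    ring
  rw [← hconst]
  ring

/-- For `f₀ = sign(x₁)` and a probability measure `μ` on `(0,∞)` with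
`∫ s^{-1/2} μ(ds) < ∞`, the mixture `G = ∫ P_s f₀ μ(ds)` is differentiable in
the first coordinate at `0` with `∂_{x₁} G(0) = π^{-1/2} ∫ s^{-1/2} μ(ds)`. -/
theorem subordinate_sign_deriv_at_zero
    (d : ℕ) (hd : 1 ≤ d)
    (f₀ : EuclideanSpace ℝ (Fin d) → ℝ)
    (hf₀ : f₀ = fun x => if 0 ≤ x ⟨0, hd⟩ then (1 : ℝ) else -1)
    (μ : Measure ℝ) [IsProbabilityMeasure μ] (hμ0 : μ (Set.Iic 0) = 0)
    (hint : IntegrableOn (fun s => s ^ (-(1 : ℝ) / 2)) (Set.Ioi 0) μ) :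
    HasDerivAt
      (fun τ : ℝ => ∫ s in Set.Ioi (0 : ℝ),
        heatSemigroup d s f₀ (τ • EuclideanSpace.single ⟨0, hd⟩ (1 : ℝ)) ∂μ)
      (Real.pi ^ (-(1 : ℝ) / 2) * ∫ s in Set.Ioi (0 : ℝ), s ^ (-(1 : ℝ) / 2) ∂μ) 0 := by
  subst hf₀
  let F : ℝ → ℝ → ℝ := fun τ s => Real.pi ^ (-(1 : ℝ) / 2) * s ^ (-(1 : ℝ) / 2) *
    ∫ v in (0 : ℝ)..τ, Real.exp (-(4 * s)⁻¹ * v ^ 2)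
  let F' : ℝ → ℝ → ℝ := fun τ s => Real.pi ^ (-(1 : ℝ) / 2) * s ^ (-(1 : ℝ) / 2) *
    Real.exp (-(4 * s)⁻¹ * τ ^ 2)
  have hF_meas (τ : ℝ) : Measurable (F τ) := by
    have hker : StronglyMeasurable
        (Function.uncurry fun s v : ℝ => Real.exp (-(4 * s)⁻¹ * v ^ 2)) :=
      Measurable.stronglyMeasurable (by unfold Function.uncurry; fun_prop)
    have hI : Measurable fun s : ℝ => ∫ v in (0 : ℝ)..τ, Real.exp (-(4 * s)⁻¹ * v ^ 2) :=
      (hker.integral_prod_right.sub hker.integral_prod_right).measurable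
    exact (measurable_const.mul (measurable_id.pow_const _)).mul hI
  have hF'_meas : Measurable (F' 0) := by
    fun_prop
  have key := (hasDerivAt_integral_of_dominated_loc_of_deriv_le
    (μ := μ.restrict (Set.Ioi 0)) (F := F) (F' := F') (x₀ := 0) (s := Set.univ)
    (bound := fun s => Real.pi ^ (-(1 : ℝ) / 2) * s ^ (-(1 : ℝ) / 2))
    Filter.univ_mem (.of_forall fun τ => (hF_meas τ).aestronglyMeasurable)
    (by simp [F]) hF'_meas.aestronglyMeasurable
    ((ae_restrict_iff' measurableSet_Ioi).2 <| .of_forall fun s hs τ _ => by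
      have hs : 0 < s := hs
      have hexp : Real.exp (-(4 * s)⁻¹ * τ ^ 2) ≤ 1 := by
        rw [Real.exp_le_one_iff, neg_mul, neg_nonpos]
        positivity
      rw [Real.norm_of_nonneg (by positivity)]
      exact mul_le_of_le_one_right (by positivity) hexp)
    (hint.const_mul _)
    (.of_forall fun s τ _ => by
      have hcont : Continuous fun v : ℝ => Real.exp (-(4 * s)⁻¹ * v ^ 2) := by fun_prop
      exact (hcont.integral_hasStrictDerivAt 0 τ).hasDerivAt.const_mul _)).2
  have hF' : ∫ s in Set.Ioi (0 : ℝ), F' 0 s ∂μ =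
      Real.pi ^ (-(1 : ℝ) / 2) * ∫ s in Set.Ioi (0 : ℝ), s ^ (-(1 : ℝ) / 2) ∂μ := by
    simp [F', integral_const_mul]
  rw [hF'] at key
  refine key.congr_of_eventuallyEq (.of_forall fun τ => ?_)
  exact setIntegral_congr_fun measurableSet_Ioi fun s hs =>
    heatSemigroup_sign_smul_single d hd hs τ
end

section
/- Let d ≥ 1, t > 0, let S:(0,∞)→[0,∞) be measurable, and let μ be a probability measure on (0,∞) satisfying ∫_{(0,∞)} e^{−λs} μ(ds) = e^{−t S(λ)} for every λ > 0, and assume A := ∫_0^∞ r^{−1/2} e^{−t S(r)} dr < ∞. Define P^S f(x) := ∫_{(0,∞)} P_s f(x) μ(ds) for bounded measurable f:ℝ^d→ℝ, where P_s is the heat semigroup on ℝ^d. Then there exists a measurable f with ‖f‖_∞ ≤ 1 such that sup_{x≠y} |P^S f(x) − P^S f(y)| / |x−y| ≥ A/(√2·π). -/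
open MeasureTheory

/-- The function on the line equal to `1` on the positive reals and to `-1` elsewhere. -/
noncomputable def signStep (z : ℝ) : ℝ := if 0 < z then 1 else -1

lemma measurable_signStep : Measurable signStep :=
  Measurable.ite measurableSet_Ioi measurable_const measurable_const

lemma abs_signStep (z : ℝ) : |signStep z| = 1 := by
  unfold signStep; split_ifs <;> simp

/-- Integrating a Gaussian against a translated step. -/
lemma integral_gaussian_mul_signStep {b : ℝ} (hb : 0 < b) (a : ℝ) :
    ∫ w, Real.exp (-b * w ^ 2) * signStep (a - w) = 2 * ∫ w in (0 : ℝ)..a, Real.exp (-b * w ^ 2) := by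
  have hint : Integrable (fun w : ℝ => Real.exp (-b * w ^ 2)) := integrable_exp_neg_mul_sq hb
  have hprod : Integrable (fun w : ℝ => Real.exp (-b * w ^ 2) * signStep (a - w)) := by
    refine hint.mul_bdd (c := 1) ?_ ?_
    · exact (measurable_signStep.comp (measurable_const.sub measurable_id)).aestronglyMeasurable
    · exact Filter.Eventually.of_forall fun w => by simp [abs_signStep]
  have hsplit := integral_add_compl (measurableSet_Iio (a := a)) hprod
  have hsplit' := integral_add_compl (measurableSet_Iio (a := a)) hint
  have h1 : ∫ w in Set.Iio a, Real.exp (-b * w ^ 2) * signStep (a - w) =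
      ∫ w in Set.Iio a, Real.exp (-b * w ^ 2) := by
    refine setIntegral_congr_fun measurableSet_Iio fun w hw => ?_
    have : 0 < a - w := sub_pos.2 hw
    simp [signStep, this]
  have h2 : ∫ w in (Set.Iio a)ᶜ, Real.exp (-b * w ^ 2) * signStep (a - w) =
      -∫ w in (Set.Iio a)ᶜ, Real.exp (-b * w ^ 2) := by
    rw [← integral_neg]
    refine setIntegral_congr_fun measurableSet_Iio.compl fun w hw => ?_
    have : ¬ 0 < a - w := by
      simpa using hw
    simp only [signStep, if_neg this, mul_neg, mul_one]
  have h3 := intervalIntegral.integral_Iic_sub_Iic (a := 0) (b := a) (μ := volume)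
    hint.integrableOn hint.integrableOn
  have h4 : ∫ w in Set.Iic (0 : ℝ), Real.exp (-b * w ^ 2) = √(Real.pi / b) / 2 := by
    rw [← integral_gaussian_Ioi b]
    have := integral_comp_neg_Iic (0 : ℝ) (fun w => Real.exp (-b * w ^ 2))
    simpa using this
  have h5 := integral_gaussian b
  rw [integral_Iic_eq_integral_Iio] at h3
  linarith

/-- The heat semigroup in `ℝ^(n+1)` applied to the step in the first coordinate. -/
lemma heatSemigroup_signStep (n : ℕ) {s : ℝ} (hs : 0 < s) (x : EuclideanSpace ℝ (Fin (n + 1))) :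
    heatSemigroup (n + 1) s (fun y => signStep (y 0)) x =
      (√(Real.pi * s))⁻¹ * ∫ w in (0 : ℝ)..x 0, Real.exp (-(1 / (4 * s)) * w ^ 2) := by
  have hb : 0 < 1 / (4 * s) := by positivity
  have hpi := Real.pi_pos
  set c := √(4 * Real.pi * s) with hc
  have hc0 : 0 < c := Real.sqrt_pos.2 (by positivity)
  have hc2 : c = 2 * √(Real.pi * s) := by
    rw [hc, show 4 * Real.pi * s = 2 ^ 2 * (Real.pi * s) by ring,
      Real.sqrt_mul (by positivity), Real.sqrt_sq (by norm_num)]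
  have hpow : (4 * Real.pi * s) ^ (-((n + 1 : ℕ) : ℝ) / 2) = (c ^ (n + 1))⁻¹ := by
    rw [neg_div, Real.rpow_neg (by positivity), hc, Real.sqrt_eq_rpow, ← Real.rpow_natCast,
      ← Real.rpow_mul (by positivity)]
    congr 2; ring
  have hgauss : ∀ a : ℝ, ∫ z, Real.exp (-(1 / (4 * s)) * (a - z) ^ 2) = c := fun a => by
    rw [integral_sub_left_eq_self (fun z => Real.exp (-(1 / (4 * s)) * z ^ 2)) volume a,
      integral_gaussian, hc]
    congr 1; field_simp
  have hstep : ∫ z, Real.exp (-(1 / (4 * s)) * (x 0 - z) ^ 2) * signStep z =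
      2 * ∫ w in (0 : ℝ)..x 0, Real.exp (-(1 / (4 * s)) * w ^ 2) := by
    rw [← integral_gaussian_mul_signStep hb,
      ← integral_sub_left_eq_self
        (fun w => Real.exp (-(1 / (4 * s)) * w ^ 2) * signStep (x 0 - w)) volume (x 0)]
    simp
  let F : Fin (n + 1) → ℝ → ℝ := Fin.cons
    (fun z => Real.exp (-(1 / (4 * s)) * (x 0 - z) ^ 2) * signStep z)
    (fun i z => Real.exp (-(1 / (4 * s)) * (x i.succ - z) ^ 2))
  have hF : ∫ y : EuclideanSpace ℝ (Fin (n + 1)),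
      Real.exp (-‖x - y‖ ^ 2 / (4 * s)) * signStep (y 0) = ∏ i, ∫ z, F i z := by
    rw [← integral_fintype_prod_volume_eq_prod,
      ← (EuclideanSpace.volume_preserving_symm_measurableEquiv_toLp (Fin (n + 1))).integral_comp'
        (g := fun y : Fin (n + 1) → ℝ => ∏ i, F i (y i))]
    refine integral_congr_ae (Filter.Eventually.of_forall fun y => ?_)
    have hexp : -‖x - y‖ ^ 2 / (4 * s) = ∑ i, -(1 / (4 * s)) * (x i - y i) ^ 2 := by
      rw [EuclideanSpace.norm_sq_eq, ← Finset.mul_sum]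
      simp only [PiLp.sub_apply, Real.norm_eq_abs, sq_abs]
      ring
    simp only [hexp, Real.exp_sum, Fin.prod_univ_succ, F, Fin.cons_zero, Fin.cons_succ]
    simp only [MeasurableEquiv.toLp_symm_apply]
    ring
  rw [heatSemigroup, hF, hpow, Fin.prod_univ_succ]
  simp only [F, Fin.cons_zero, Fin.cons_succ, hgauss, hstep, Finset.prod_const, Finset.card_univ,
    Fintype.card_fin]
  rw [pow_succ, hc2]
  have : 0 < √(Real.pi * s) := Real.sqrt_pos.2 (by positivity)
  field_simp

/-- The `-1/2` moment of a measure on the half line in terms of its Laplace transform. -/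
lemma integral_inv_sqrt_of_laplace (μ : Measure ℝ) [IsFiniteMeasure μ] (L : ℝ → ℝ)
    (hL : ∀ l ∈ Set.Ioi (0 : ℝ), ∫ s in Set.Ioi (0 : ℝ), Real.exp (-(l * s)) ∂μ = L l)
    (hA : IntegrableOn (fun r => r ^ (-(1 : ℝ) / 2) * L r) (Set.Ioi 0) volume) :
    IntegrableOn (fun s => (√(Real.pi * s))⁻¹) (Set.Ioi 0) μ ∧
      ∫ s in Set.Ioi (0 : ℝ), (√(Real.pi * s))⁻¹ ∂μ =
        (∫ r in Set.Ioi (0 : ℝ), r ^ (-(1 : ℝ) / 2) * L r) / Real.pi := by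
  let F : ℝ → ℝ → ℝ := fun r s => r ^ (-(1 : ℝ) / 2) * Real.exp (-(r * s))
  have hFmeas : Measurable (Function.uncurry F) := by
    unfold F Function.uncurry; fun_prop
  have hFr : ∀ r ∈ Set.Ioi (0 : ℝ),
      ∫ s in Set.Ioi (0 : ℝ), F r s ∂μ = r ^ (-(1 : ℝ) / 2) * L r := fun r hr => by
    simp only [F]
    rw [integral_const_mul, hL r hr]
  have hFs : ∀ s ∈ Set.Ioi (0 : ℝ),
      ∫ r in Set.Ioi (0 : ℝ), F r s = Real.pi * (√(Real.pi * s))⁻¹ := fun s hs => by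
    have hs : 0 < s := hs
    have h := Real.integral_rpow_mul_exp_neg_mul_Ioi (a := 1 / 2) (r := s) (by norm_num) hs
    rw [Real.Gamma_one_half_eq, ← Real.sqrt_eq_rpow] at h
    have h' : ∫ r in Set.Ioi (0 : ℝ), F r s = √(1 / s) * √Real.pi := by
      rw [← h]
      refine setIntegral_congr_fun measurableSet_Ioi fun r _ => ?_
      simp only [F]
      rw [mul_comm r s]; norm_num
    rw [h', Real.sqrt_mul Real.pi_pos.le, Real.sqrt_div zero_le_one, Real.sqrt_one]
    have h1 : 0 < √Real.pi := Real.sqrt_pos.2 Real.pi_pos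
    have h2 : 0 < √s := Real.sqrt_pos.2 hs
    field_simp
    exact Real.sq_sqrt Real.pi_pos.le
  have hint : Integrable (Function.uncurry F)
      ((volume.restrict (Set.Ioi 0)).prod (μ.restrict (Set.Ioi 0))) := by
    rw [integrable_prod_iff hFmeas.aestronglyMeasurable]
    constructor
    · refine (ae_restrict_iff' measurableSet_Ioi).2 (Filter.Eventually.of_forall fun r hr => ?_)
      have hr : 0 < r := hr
      suffices h : Integrable (fun s : ℝ => Real.exp (-(r * s))) (μ.restrict (Set.Ioi 0)) from
        h.const_mul (r ^ (-(1 : ℝ) / 2))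
      refine Integrable.mono' (integrable_const (1 : ℝ))
        (by fun_prop) ((ae_restrict_iff' measurableSet_Ioi).2 (Filter.Eventually.of_forall ?_))
      intro s hs
      have hs : 0 < s := hs
      rw [Real.norm_eq_abs, Real.abs_exp, Real.exp_le_one_iff]
      have := mul_pos hr hs
      linarith
    · refine hA.congr_fun (fun r hr => ?_) measurableSet_Ioi
      have hr' : 0 < r := hr
      dsimp only
      rw [← hFr r hr]
      refine integral_congr_ae (Filter.Eventually.of_forall fun s => ?_)
      have : 0 ≤ F r s := by simp only [F]; positivity
      exact (Real.norm_of_nonneg this).symm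
  have hpi : Real.pi ≠ 0 := Real.pi_ne_zero
  constructor
  · have h := (hint.integral_prod_right.const_mul Real.pi⁻¹)
    refine IntegrableOn.congr_fun h (fun s hs => ?_) measurableSet_Ioi
    simp only [Function.uncurry_apply_pair]
    rw [hFs s hs, inv_mul_cancel_left₀ hpi]
  · have h := integral_integral_swap hint
    rw [setIntegral_congr_fun measurableSet_Ioi hFr, setIntegral_congr_fun measurableSet_Ioi hFs,
      integral_const_mul] at h
    rw [h, mul_div_cancel_left₀ _ hpi]

/-- Sharpness of the gradient estimate: there is a measurable `f` with `‖f‖_∞ ≤ 1`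
such that the best Lipschitz constant of the subordinate semigroup `P^S f`
is at least `A / (√2 · π)`, where `A = ∫_0^∞ r^{-1/2} e^{-tS(r)} dr`. -/
theorem subordinate_heatSemigroup_lower_bound
    (d : ℕ) (hd : 1 ≤ d) (t : ℝ) (ht : 0 < t)
    (S : ℝ → ℝ) (hSmeas : Measurable S) (hSnonneg : ∀ r ∈ Set.Ioi (0 : ℝ), 0 ≤ S r)
    (μ : Measure ℝ) [IsProbabilityMeasure μ] (hμ0 : μ (Set.Iic 0) = 0)
    (hLaplace : ∀ l ∈ Set.Ioi (0 : ℝ),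
      ∫ s in Set.Ioi (0 : ℝ), Real.exp (-(l * s)) ∂μ = Real.exp (-(t * S l)))
    (hA : IntegrableOn (fun r => r ^ (-(1 : ℝ) / 2) * Real.exp (-(t * S r)))
      (Set.Ioi 0) volume) :
    ∃ f : EuclideanSpace ℝ (Fin d) → ℝ, Measurable f ∧ (∀ x, |f x| ≤ 1) ∧
      (∫ r in Set.Ioi (0 : ℝ), r ^ (-(1 : ℝ) / 2) * Real.exp (-(t * S r)))
          / (Real.sqrt 2 * Real.pi)
        ≤ sSup {q : ℝ | ∃ x y : EuclideanSpace ℝ (Fin d), x ≠ y ∧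
            q = |(∫ s in Set.Ioi (0 : ℝ), heatSemigroup d s f x ∂μ)
                  - ∫ s in Set.Ioi (0 : ℝ), heatSemigroup d s f y ∂μ| / ‖x - y‖} := by
  obtain ⟨n, rfl⟩ : ∃ n, d = n + 1 := ⟨d - 1, by omega⟩
  set A := ∫ r in Set.Ioi (0 : ℝ), r ^ (-(1 : ℝ) / 2) * Real.exp (-(t * S r)) with hAdef
  obtain ⟨hKint, hKeq⟩ :=
    integral_inv_sqrt_of_laplace μ (fun l => Real.exp (-(t * S l))) hLaplace hA
  rw [← hAdef] at hKeq
  refine ⟨fun y => signStep (y 0), measurable_signStep.comp (by fun_prop),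
    fun x => (abs_signStep _).le, ?_⟩
  let G : ℝ → ℝ → ℝ := fun a s =>
    (√(Real.pi * s))⁻¹ * ∫ w in (0 : ℝ)..a, Real.exp (-(1 / (4 * s)) * w ^ 2)
  have hP : ∀ x : EuclideanSpace ℝ (Fin (n + 1)),
      ∫ s in Set.Ioi (0 : ℝ), heatSemigroup (n + 1) s (fun y => signStep (y 0)) x ∂μ =
        ∫ s in Set.Ioi (0 : ℝ), G (x 0) s ∂μ := fun x =>
    setIntegral_congr_fun measurableSet_Ioi fun s hs => heatSemigroup_signStep n hs x
  simp only [hP]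
  have hcont : ∀ s : ℝ, Continuous fun w : ℝ => Real.exp (-(1 / (4 * s)) * w ^ 2) := by
    intro s; fun_prop
  have hGsub : ∀ a b s, G a s - G b s =
      (√(Real.pi * s))⁻¹ * ∫ w in b..a, Real.exp (-(1 / (4 * s)) * w ^ 2) := fun a b s => by
    simp only [G]
    rw [← mul_sub, intervalIntegral.integral_interval_sub_left
      ((hcont s).intervalIntegrable _ _) ((hcont s).intervalIntegrable _ _)]
  have hGbound : ∀ a b, ∀ s ∈ Set.Ioi (0 : ℝ),
      ‖G a s - G b s‖ ≤ (√(Real.pi * s))⁻¹ * |a - b| := fun a b s hs => by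
    have hs : 0 < s := hs
    rw [hGsub, norm_mul, Real.norm_of_nonneg (inv_nonneg.2 (Real.sqrt_nonneg _))]
    refine mul_le_mul_of_nonneg_left ?_ (inv_nonneg.2 (Real.sqrt_nonneg _))
    refine (intervalIntegral.norm_integral_le_of_norm_le_const (C := 1) fun w _ => ?_).trans
      (one_mul _).le
    rw [Real.norm_eq_abs, Real.abs_exp, Real.exp_le_one_iff]
    have : 0 ≤ 1 / (4 * s) * w ^ 2 := by positivity
    linarith
  have hGint : ∀ a, IntegrableOn (G a) (Set.Ioi 0) μ := fun a => by
    refine Integrable.mono' (hKint.mul_const |a - 0|) ?_ ?_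
    · have hm : Measurable (Function.uncurry fun s w : ℝ =>
          Real.exp (-(1 / (4 * s)) * w ^ 2)) := by
        unfold Function.uncurry; fun_prop
      have hmi : ∀ T : Set ℝ, StronglyMeasurable fun s : ℝ =>
          ∫ w in T, Real.exp (-(1 / (4 * s)) * w ^ 2) := fun T =>
        hm.stronglyMeasurable.integral_prod_right
      refine AEStronglyMeasurable.mul (by fun_prop) ?_
      simp only [intervalIntegral]
      exact ((hmi _).sub (hmi _)).aestronglyMeasurable
    · refine (ae_restrict_iff' measurableSet_Ioi).2 (Filter.Eventually.of_forall fun s hs => ?_)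
      simpa [G] using hGbound a 0 s hs
  have hLip : ∀ a b, |(∫ s in Set.Ioi (0 : ℝ), G a s ∂μ) - ∫ s in Set.Ioi (0 : ℝ), G b s ∂μ| ≤
      A / Real.pi * |a - b| := fun a b => by
    rw [← integral_sub (hGint a) (hGint b), ← hKeq, ← integral_mul_const]
    exact norm_integral_le_of_norm_le (hKint.mul_const _)
      ((ae_restrict_iff' measurableSet_Ioi).2 (Filter.Eventually.of_forall (hGbound a b)))
  have hA0 : 0 ≤ A / Real.pi := by
    rw [← hKeq]
    exact integral_nonneg fun s => inv_nonneg.2 (Real.sqrt_nonneg _)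
  set Q : Set ℝ := {q : ℝ | ∃ x y : EuclideanSpace ℝ (Fin (n + 1)), x ≠ y ∧
    q = |(∫ s in Set.Ioi (0 : ℝ), G (x 0) s ∂μ) - ∫ s in Set.Ioi (0 : ℝ), G (y 0) s ∂μ| /
      ‖x - y‖} with hQ
  have hbdd : BddAbove Q := by
    refine ⟨A / Real.pi, ?_⟩
    rintro q ⟨x, y, hxy, rfl⟩
    rw [div_le_iff₀ (norm_pos_iff.2 (sub_ne_zero.2 hxy))]
    refine (hLip _ _).trans (mul_le_mul_of_nonneg_left ?_ hA0)
    simpa using PiLp.norm_apply_le (x - y) 0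
  have hlow : ∀ a : ℝ, 0 < a →
      ∫ s in Set.Ioi (0 : ℝ), (√(Real.pi * s))⁻¹ * Real.exp (-(1 / (4 * s)) * a ^ 2) ∂μ ≤
        sSup Q := fun a ha => by
    have hmem : (∫ s in Set.Ioi (0 : ℝ), G a s ∂μ) / a ∈ Q := by
      refine ⟨EuclideanSpace.single 0 a, 0, by simpa using ha.ne', ?_⟩
      have hG0 : ∀ s, G 0 s = 0 := fun s => by simp [G]
      have hnn : 0 ≤ ∫ s in Set.Ioi (0 : ℝ), G a s ∂μ := integral_nonneg fun s =>
        mul_nonneg (inv_nonneg.2 (Real.sqrt_nonneg _))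
          (intervalIntegral.integral_nonneg ha.le fun w _ => (Real.exp_pos _).le)
      simp [hG0, abs_of_nonneg hnn, abs_of_pos ha]
    refine le_trans ?_ (le_csSup hbdd hmem)
    rw [← integral_div]
    refine integral_mono_of_nonneg (Filter.Eventually.of_forall fun s =>
      mul_nonneg (inv_nonneg.2 (Real.sqrt_nonneg _)) (Real.exp_pos _).le)
      ((hGint a).div_const a)
      ((ae_restrict_iff' measurableSet_Ioi).2 (Filter.Eventually.of_forall fun s hs => ?_))
    have hs : 0 < s := hs
    simp only [G]
    rw [mul_div_assoc]
    refine mul_le_mul_of_nonneg_left ?_ (inv_nonneg.2 (Real.sqrt_nonneg _))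
    rw [le_div_iff₀ ha]
    have hmono := intervalIntegral.integral_mono_on (μ := volume) ha.le
      (f := fun _ => Real.exp (-(1 / (4 * s)) * a ^ 2))
      (continuous_const.intervalIntegrable _ _) ((hcont s).intervalIntegrable _ _)
      (fun w hw => by
        refine Real.exp_le_exp.2 (mul_le_mul_of_nonpos_left
          (pow_le_pow_left₀ hw.1 hw.2 2) ?_)
        have : 0 < 1 / (4 * s) := by positivity
        linarith)
    simpa [mul_comm] using hmono
  have hlim : Filter.Tendsto (fun a : ℝ => ∫ s in Set.Ioi (0 : ℝ),
      (√(Real.pi * s))⁻¹ * Real.exp (-(1 / (4 * s)) * a ^ 2) ∂μ)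
      (nhdsWithin 0 (Set.Ioi 0)) (nhds (A / Real.pi)) := by
    rw [← hKeq]
    refine tendsto_integral_filter_of_dominated_convergence (fun s => (√(Real.pi * s))⁻¹)
      (Filter.Eventually.of_forall fun a => by fun_prop)
      (Filter.Eventually.of_forall fun a => (ae_restrict_iff' measurableSet_Ioi).2
        (Filter.Eventually.of_forall fun s hs => ?_)) hKint
      (Filter.Eventually.of_forall fun s => ?_)
    · have hs : 0 < s := hs
      rw [norm_mul, Real.norm_of_nonneg (inv_nonneg.2 (Real.sqrt_nonneg _)), Real.norm_eq_abs,
        Real.abs_exp]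
      refine mul_le_of_le_one_right (inv_nonneg.2 (Real.sqrt_nonneg _)) ?_
      rw [Real.exp_le_one_iff]
      have : 0 ≤ 1 / (4 * s) * a ^ 2 := by positivity
      linarith
    · have hc : Continuous fun a : ℝ =>
          (√(Real.pi * s))⁻¹ * Real.exp (-(1 / (4 * s)) * a ^ 2) := by fun_prop
      simpa using (hc.tendsto 0).mono_left nhdsWithin_le_nhds
  have hmain : A / Real.pi ≤ sSup Q :=
    le_of_tendsto hlim (Filter.eventually_of_mem self_mem_nhdsWithin hlow)
  refine le_trans ?_ hmain
  rw [mul_comm, ← div_div]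
  exact div_le_self hA0 (Real.one_le_sqrt.2 one_le_two)
end

section
/- Let d ≥ 1 and let u ∈ ℝ^d with u ≠ 0. Then ∫_{{z : 0 < |z| ≤ |u|^{−1}}} (1 − cos⟨u,z⟩) |z|^{−d} dz = ∫_{{z : 0 < |z| ≤ 1}} (1 − cos z₁) |z|^{−d} dz, where z₁ denotes the first coordinate of z and ⟨·,·⟩ the Euclidean inner product. -/
open MeasureTheory
open scoped RealInnerProductSpace

/-- An integral over a radial region of a function of `⟪v, z⟫` and `‖z‖` depends on `v` only
through `‖v‖`. -/
theorem setIntegral_inner_norm_eq_of_norm_eq {E : Type*} [NormedAddCommGroup E]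
    [InnerProductSpace ℝ E] [FiniteDimensional ℝ E] [MeasurableSpace E] [BorelSpace E]
    {F : Type*} [NormedAddCommGroup F] [NormedSpace ℝ F]
    (f : ℝ → ℝ → F) (S : Set ℝ) {v w : E} (h : ‖v‖ = ‖w‖) :
    ∫ z in {z : E | ‖z‖ ∈ S}, f ⟪v, z⟫ ‖z‖ = ∫ z in {z : E | ‖z‖ ∈ S}, f ⟪w, z⟫ ‖z‖ := by
  set ρ := (ℝ ∙ (v - w))ᗮ.reflection with hρ
  have hv : ρ v = w := Submodule.reflection_sub h
  have key := ρ.measurePreserving.setIntegral_preimage_emb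
    ρ.toHomeomorph.measurableEmbedding (fun z => f ⟪w, z⟫ ‖z‖) {z : E | ‖z‖ ∈ S}
  rw [← key]
  simp only [Set.preimage_ofPred_eq, ρ.norm_map, ← hv, ρ.inner_map_map]

open scoped Pointwise in
/-- Scaling by `r > 0` sends the punctured closed ball of radius `r⁻¹` to that of radius `1`. -/
theorem smul_punctured_closedBall_inv {E : Type*} [NormedAddCommGroup E] [NormedSpace ℝ E]
    {r : ℝ} (hr : 0 < r) :
    r • {z : E | 0 < ‖z‖ ∧ ‖z‖ ≤ r⁻¹} = {z : E | 0 < ‖z‖ ∧ ‖z‖ ≤ 1} := by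
  ext z
  rw [Set.mem_smul_set_iff_inv_smul_mem₀ hr.ne']
  simp only [Set.mem_ofPred_eq, norm_smul, norm_inv, Real.norm_of_nonneg hr.le]
  rw [mul_pos_iff_of_pos_left (inv_pos.2 hr), mul_le_iff_le_one_right (inv_pos.2 hr)]

/-- Scaling/rotation invariance: for `u ≠ 0`,
`∫_{0<|z|≤|u|⁻¹} (1 - cos⟨u,z⟩)|z|^{-d} dz = ∫_{0<|z|≤1} (1 - cos z₁)|z|^{-d} dz`. -/
theorem cos_kernel_integral_invariant
    (d : ℕ) (hd : 1 ≤ d) (u : EuclideanSpace ℝ (Fin d)) (hu : u ≠ 0) :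
    ∫ z in {z : EuclideanSpace ℝ (Fin d) | 0 < ‖z‖ ∧ ‖z‖ ≤ ‖u‖⁻¹},
        (1 - Real.cos ⟪u, z⟫) * ‖z‖ ^ (-(d : ℝ))
      = ∫ z in {z : EuclideanSpace ℝ (Fin d) | 0 < ‖z‖ ∧ ‖z‖ ≤ 1},
          (1 - Real.cos (z ⟨0, hd⟩)) * ‖z‖ ^ (-(d : ℝ)) := by
  have hr : 0 < ‖u‖ := norm_pos_iff.2 hu
  have hrd : ‖u‖ ^ d ≠ 0 := (pow_pos hr d).ne'
  set e : EuclideanSpace ℝ (Fin d) := EuclideanSpace.single ⟨0, hd⟩ 1 with he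
  have hnorm : ‖u‖ = ‖‖u‖ • e‖ := by simp [he, norm_smul]
  have hinner (z : EuclideanSpace ℝ (Fin d)) : ⟪e, z⟫ = z ⟨0, hd⟩ := by
    simp [he, EuclideanSpace.inner_single_left]
  have hscale := Measure.setIntegral_comp_smul_of_pos volume
    (fun z : EuclideanSpace ℝ (Fin d) => (1 - Real.cos (z ⟨0, hd⟩)) * ‖z‖ ^ (-(d : ℝ)))
    {z | 0 < ‖z‖ ∧ ‖z‖ ≤ ‖u‖⁻¹} hr
  rw [smul_punctured_closedBall_inv hr, finrank_euclideanSpace_fin, smul_eq_mul] at hscale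
  have hrot := setIntegral_inner_norm_eq_of_norm_eq
    (fun s t : ℝ => (1 - Real.cos s) * t ^ (-(d : ℝ))) (Set.Ioc 0 ‖u‖⁻¹) hnorm
  simp only [Set.mem_Ioc] at hrot
  rw [hrot, ← mul_right_inj' (inv_ne_zero hrd), ← hscale, ← integral_const_mul]
  congr 1 with z
  rw [inner_smul_left, hinner, norm_smul, norm_norm, Real.mul_rpow hr.le (norm_nonneg z),
    Real.rpow_neg hr.le, Real.rpow_natCast, PiLp.smul_apply, smul_eq_mul, RCLike.conj_to_real]
  ring
end

section
/- Let ε > 0. There exist constants c₁, c₂ ∈ (0,∞) such that for every t ∈ (0,1], ∫_0^∞ r^{−1/2} exp(−t·(log(1 + r^{1/(1+ε)}))^{1+ε}) dr ≤ c₁ exp(c₂ t^{−1/ε}). -/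
open MeasureTheory

theorem mul_le_mul_rpow_add {ε t k L : ℝ} (hε : 0 < ε) (ht : 0 < t) (hk : 0 < k)
    (hL : 0 ≤ L) :
    k * L ≤ t * L ^ (1 + ε) + k * k ^ (1 / ε) * t ^ (-(1 : ℝ) / ε) := by
  have hdiv : (k / t) ^ (1 / ε) = k ^ (1 / ε) * t ^ (-(1 : ℝ) / ε) := by
    rw [Real.div_rpow hk.le ht.le, neg_div, Real.rpow_neg ht.le, div_eq_mul_inv]
  rw [mul_assoc, ← hdiv]
  have hM : 0 < (k / t) ^ (1 / ε) := by positivity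
  rcases le_total L ((k / t) ^ (1 / ε)) with h | h
  · have h₁ : k * L ≤ k * (k / t) ^ (1 / ε) := by gcongr
    have h₂ : 0 ≤ t * L ^ (1 + ε) := by positivity
    linarith
  · have hLpos : 0 < L := hM.trans_le h
    have h₁ : k / t ≤ L ^ ε := by
      have := Real.rpow_le_rpow hM.le h hε.le
      rwa [← Real.rpow_mul (by positivity), one_div_mul_cancel hε.ne', Real.rpow_one] at this
    have h₂ : k ≤ t * L ^ ε := by
      rw [div_le_iff₀ ht] at h₁
      linarith
    rw [Real.rpow_add hLpos, Real.rpow_one]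
    have h₃ : k * L ≤ t * L ^ ε * L := by gcongr
    have h₄ : 0 ≤ k * (k / t) ^ (1 / ε) := by positivity
    linarith

theorem exp_neg_mul_log_one_add_rpow_le {a r : ℝ} (ha : 0 < a) (hr : 0 < r) :
    Real.exp (-(a * Real.log (1 + r ^ (1 / a)))) ≤ min 1 r⁻¹ := by
  have hs : 0 < r ^ (1 / a) := by positivity
  have hlog : 0 ≤ Real.log (1 + r ^ (1 / a)) := Real.log_nonneg (by linarith)
  refine le_min (Real.exp_le_one_iff.mpr (neg_nonpos.mpr (by positivity))) ?_
  rw [← Real.exp_log (inv_pos.mpr hr), Real.log_inv]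
  gcongr
  have h : Real.log (r ^ (1 / a)) ≤ Real.log (1 + r ^ (1 / a)) :=
    Real.log_le_log hs (by linarith)
  rw [Real.log_rpow hr] at h
  calc Real.log r = a * (1 / a * Real.log r) := by field_simp
    _ ≤ _ := by gcongr

theorem integrableOn_rpow_neg_half_mul_min :
    IntegrableOn (fun r : ℝ => r ^ (-(1 : ℝ) / 2) * min 1 r⁻¹) (Set.Ioi 0) := by
  rw [← Set.Ioc_union_Ioi_eq_Ioi zero_le_one, integrableOn_union]
  constructor
  · have h : IntegrableOn (fun r : ℝ => r ^ (-(1 : ℝ) / 2)) (Set.Ioc 0 1) :=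
      (intervalIntegrable_iff_integrableOn_Ioc_of_le zero_le_one).mp
        (intervalIntegral.intervalIntegrable_rpow' (by norm_num))
    refine h.congr_fun (fun r hr => ?_) measurableSet_Ioc
    simp only [min_eq_left ((one_le_inv₀ hr.1).mpr hr.2), mul_one]
  · have h : IntegrableOn (fun r : ℝ => r ^ (-(3 : ℝ) / 2)) (Set.Ioi 1) :=
      integrableOn_Ioi_rpow_of_lt (by norm_num) one_pos
    refine h.congr_fun (fun r hr => ?_) measurableSet_Ioi
    have hr₁ : (1 : ℝ) < r := hr
    have hr₀ : 0 < r := one_pos.trans hr₁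
    simp only [min_eq_right (inv_le_one_of_one_le₀ hr₁.le)]
    rw [← Real.rpow_neg_one, ← Real.rpow_add hr₀]
    norm_num

/-- For the Bernstein function `S_ε(r) = (log(1 + r^{1/(1+ε)}))^{1+ε}` there are
constants `c₁, c₂ ∈ (0,∞)` with
`∫_0^∞ r^{-1/2} e^{-t S_ε(r)} dr ≤ c₁ exp(c₂ t^{-1/ε})` for all `t ∈ (0,1]`. -/
theorem alpha_bound_log_bernstein
    (ε : ℝ) (hε : 0 < ε) :
    ∃ c₁ ∈ Set.Ioi (0 : ℝ), ∃ c₂ ∈ Set.Ioi (0 : ℝ),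
      ∀ t ∈ Set.Ioc (0 : ℝ) 1,
        (∫ r in Set.Ioi (0 : ℝ),
            r ^ (-(1 : ℝ) / 2)
              * Real.exp (-(t * (Real.log (1 + r ^ (1 / (1 + ε)))) ^ (1 + ε))))
          ≤ c₁ * Real.exp (c₂ * t ^ (-(1 : ℝ) / ε)) := by
  have ha : 0 < 1 + ε := by linarith
  set I := ∫ r in Set.Ioi (0 : ℝ), r ^ (-(1 : ℝ) / 2) * min 1 r⁻¹ with hI
  have hI₀ : 0 ≤ I := setIntegral_nonneg measurableSet_Ioi fun r hr => by
    have : (0 : ℝ) < r := hr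
    positivity
  refine ⟨I + 1, Set.mem_Ioi.mpr (by linarith), (1 + ε) * (1 + ε) ^ (1 / ε),
    Set.mem_Ioi.mpr (by positivity), fun t ht => ?_⟩
  set E := Real.exp ((1 + ε) * (1 + ε) ^ (1 / ε) * t ^ (-(1 : ℝ) / ε)) with hE
  have hE₀ : 0 < E := Real.exp_pos _
  calc _ ≤ ∫ r in Set.Ioi (0 : ℝ), r ^ (-(1 : ℝ) / 2) * min 1 r⁻¹ * E := by
        refine integral_mono_of_nonneg ?_ (integrableOn_rpow_neg_half_mul_min.mul_const E) ?_
        · filter_upwards [ae_restrict_mem measurableSet_Ioi] with r hr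
          have hr₀ : (0 : ℝ) < r := hr
          simp only [Pi.zero_apply]
          positivity
        · filter_upwards [ae_restrict_mem measurableSet_Ioi] with r hr
          have hr₀ : (0 : ℝ) < r := hr
          have hs : 0 < r ^ (1 / (1 + ε)) := by positivity
          have hlog : 0 ≤ Real.log (1 + r ^ (1 / (1 + ε))) := Real.log_nonneg (by linarith)
          have hY := mul_le_mul_rpow_add hε ht.1 ha hlog
          rw [mul_assoc]
          gcongr
          calc _ ≤ Real.exp (-((1 + ε) * Real.log (1 + r ^ (1 / (1 + ε))))
                  + (1 + ε) * (1 + ε) ^ (1 / ε) * t ^ (-(1 : ℝ) / ε)) :=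
                Real.exp_le_exp.mpr (by linarith)
            _ ≤ _ := by
                rw [Real.exp_add]
                gcongr
                exact exp_neg_mul_log_one_add_rpow_le ha hr₀
    _ = I * E := integral_mul_const E _
    _ ≤ (I + 1) * E := by gcongr; linarith
end

section
/- Let r₀ > 0 and let S:[0,∞)→[0,∞) be nondecreasing and continuously differentiable on (0,∞) with S' nonincreasing and S(0) = 0 (with S continuous at 0). Then ∫_{r₀}^∞ ( S(r₀^{−2}) r^{−2} + r^{−4} S'(r^{−2}/4) ) dr ≤ (3/r₀) S(r₀^{−2}). -/
open MeasureTheory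

/-- A function that is monotone on `[a, ∞)` has nonnegative derivative on `(a, ∞)`. -/
theorem nonneg_of_hasDerivAt_of_monotoneOn_Ici {f : ℝ → ℝ} {a x f' : ℝ}
    (hf : MonotoneOn f (Set.Ici a)) (hx : a < x) (h : HasDerivAt f f' x) : 0 ≤ f' := by
  have hnhds : Set.Ici a ∈ nhds x := Ici_mem_nhds hx
  rw [← h.deriv, ← derivWithin_of_mem_nhds hnhds]
  exact hf.derivWithin_nonneg

/-- Key integral estimate:
`∫_{r₀}^∞ (S(r₀^{-2}) r^{-2} + r^{-4} S'(r^{-2}/4)) dr ≤ (3/r₀) S(r₀^{-2})`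
for a nondecreasing `S : [0,∞) → [0,∞)`, continuous at `0` with `S(0) = 0` and
continuously differentiable on `(0,∞)` with nonincreasing derivative `S'`. -/
theorem gradient_integral_estimate
    (r₀ : ℝ) (hr₀ : 0 < r₀)
    (S S' : ℝ → ℝ)
    (hmono : MonotoneOn S (Set.Ici 0))
    (hderiv : ∀ r ∈ Set.Ioi (0 : ℝ), HasDerivAt S (S' r) r)
    (hS'cont : ContinuousOn S' (Set.Ioi 0))
    (hS'anti : AntitoneOn S' (Set.Ioi 0))
    (hS0 : S 0 = 0) (hScont : ContinuousAt S 0)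
    (hSnonneg : ∀ r ∈ Set.Ici (0 : ℝ), 0 ≤ S r) :
    ∫ r in Set.Ioi r₀,
        (S (r₀ ^ (-(2 : ℝ))) * r ^ (-(2 : ℝ)) + r ^ (-(4 : ℝ)) * S' (r ^ (-(2 : ℝ)) / 4))
      ≤ (3 / r₀) * S (r₀ ^ (-(2 : ℝ))) := by
  have hS'nonneg : ∀ x, 0 < x → 0 ≤ S' x := fun x hx ↦
    nonneg_of_hasDerivAt_of_monotoneOn_Ici hmono hx (hderiv x hx)
  set A := S (r₀ ^ (-(2 : ℝ)))
  have hA0 : 0 ≤ A := hSnonneg _ (Real.rpow_nonneg hr₀.le _)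
  have hG : ∀ r ∈ Set.Ici r₀, HasDerivAt
      (fun r : ℝ ↦ -(A * r⁻¹) - 2 / r₀ * S (r ^ (-(2 : ℝ)) / 4))
      (A * r ^ (-(2 : ℝ)) + r₀⁻¹ * r ^ (-(3 : ℝ)) * S' (r ^ (-(2 : ℝ)) / 4)) r := by
    intro r hr
    have hr0 : 0 < r := hr₀.trans_le hr
    have hpos : 0 < r ^ (-(2 : ℝ)) / 4 := by positivity
    have hpow := (Real.hasDerivAt_rpow_const (p := -(2 : ℝ)) (Or.inl hr0.ne')).div_const 4
    have hS := (hderiv _ hpos).comp r hpow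
    refine (((hasDerivAt_inv hr0.ne').const_mul A).neg.sub
      (hS.const_mul (2 / r₀))).congr_deriv ?_
    have h2 : (r ^ 2)⁻¹ = r ^ (-(2 : ℝ)) := by
      rw [Real.rpow_neg hr0.le, Real.rpow_two]
    have h3 : (-(2 : ℝ) - 1) = -3 := by norm_num
    rw [h3, h2]
    ring
  have hGnonneg : ∀ r ∈ Set.Ioi r₀,
      0 ≤ A * r ^ (-(2 : ℝ)) + r₀⁻¹ * r ^ (-(3 : ℝ)) * S' (r ^ (-(2 : ℝ)) / 4) := by
    intro r hr
    have hr0 : 0 < r := hr₀.trans hr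
    have := hS'nonneg (r ^ (-(2 : ℝ)) / 4) (by positivity)
    positivity
  have hlim : Filter.Tendsto
      (fun r : ℝ ↦ -(A * r⁻¹) - 2 / r₀ * S (r ^ (-(2 : ℝ)) / 4)) Filter.atTop (nhds 0) := by
    have hpow : Filter.Tendsto (fun r : ℝ ↦ r ^ (-(2 : ℝ)) / 4) Filter.atTop (nhds 0) := by
      simpa using (tendsto_rpow_neg_atTop (zero_lt_two' ℝ)).div_const 4
    have hS := hScont.tendsto.comp hpow
    rw [hS0] at hS
    simpa using (tendsto_inv_atTop_zero.const_mul A).neg.sub (hS.const_mul (2 / r₀))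
  have hint := integral_Ioi_of_hasDerivAt_of_nonneg' hG hGnonneg hlim
  have hintegrable := integrableOn_Ioi_deriv_of_nonneg' hG hGnonneg hlim
  have hle : S (r₀ ^ (-(2 : ℝ)) / 4) ≤ A := by
    have hpos : 0 < r₀ ^ (-(2 : ℝ)) := by positivity
    exact hmono (by simp only [Set.mem_Ici]; positivity) hpos.le (by linarith)
  calc
    _ ≤ ∫ r in Set.Ioi r₀,
        (A * r ^ (-(2 : ℝ)) + r₀⁻¹ * r ^ (-(3 : ℝ)) * S' (r ^ (-(2 : ℝ)) / 4)) := by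
      refine integral_mono_of_nonneg ?_ hintegrable ?_ <;>
        refine (ae_restrict_mem measurableSet_Ioi).mono fun r (hr : r₀ < r) ↦ ?_ <;>
        have hr0 : 0 < r := hr₀.trans hr <;>
        have hS' := hS'nonneg (r ^ (-(2 : ℝ)) / 4) (by positivity)
      · simp only [Pi.zero_apply]
        positivity
      · have h4 : r ^ (-(4 : ℝ)) = r⁻¹ * r ^ (-(3 : ℝ)) := by
          rw [← Real.rpow_neg_one, ← Real.rpow_add hr0]
          norm_num
        simp only [h4]
        gcongr
    _ = A * r₀⁻¹ + 2 / r₀ * S (r₀ ^ (-(2 : ℝ)) / 4) := by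
      rw [hint]
      ring
    _ ≤ A * r₀⁻¹ + 2 / r₀ * A := by gcongr
    _ = 3 / r₀ * A := by ring
end

section
/- Let d ≥ 1, r₀ > 0, and let S:[0,∞)→[0,∞) be nondecreasing and continuously differentiable on (0,∞) with S' nonincreasing and S(0) = 0. Define ρ₀(z) := (max(r₀,|z|))^{−d} S((max(r₀,|z|))^{−2}). Then there exists a constant c ∈ (0,∞) depending only on d such that ∫_{ℝ^d} ( sup_{x : |x−z| < r₀/2, |x| ≠ r₀} ‖∇ρ₀(x)‖ ) dz ≤ (c/r₀) S(r₀^{−2}). -/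
open MeasureTheory

/-- A nonnegative monotone function `S` on `[0, ∞)` whose derivative `S'` is antitone on `(0, ∞)`
satisfies `0 ≤ S' s` and `s * S' s ≤ 2 * S s` for `s > 0`. -/
lemma deriv_nonneg_and_mul_deriv_le {S S' : ℝ → ℝ} (hmono : MonotoneOn S (Set.Ici 0))
    (hderiv : ∀ r ∈ Set.Ioi (0 : ℝ), HasDerivAt S (S' r) r)
    (hanti : AntitoneOn S' (Set.Ioi 0)) (hnonneg : ∀ r ∈ Set.Ici (0 : ℝ), 0 ≤ S r)
    {s : ℝ} (hs : 0 < s) : 0 ≤ S' s ∧ s * S' s ≤ 2 * S s := by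
  have mvt : ∀ a b : ℝ, 0 < a → a < b → ∃ ξ ∈ Set.Ioo a b, S' ξ = (S b - S a) / (b - a) := by
    intro a b ha hab
    refine exists_hasDerivAt_eq_slope S S' hab (fun x hx => ?_) (fun x hx => ?_)
    · exact (hderiv x (ha.trans_le hx.1)).continuousAt.continuousWithinAt
    · exact hderiv x (ha.trans hx.1)
  constructor
  · obtain ⟨ξ, hξ, h⟩ := mvt s (2 * s) hs (by linarith)
    have h1 : S' ξ ≤ S' s := hanti hs (hs.trans hξ.1) hξ.1.le
    have h2 : S s ≤ S (2 * s) :=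
      hmono hs.le (show (0 : ℝ) ≤ 2 * s by linarith) (by linarith)
    have h3 : 0 ≤ S' ξ := by
      rw [h]
      exact div_nonneg (by linarith) (by linarith)
    linarith
  · obtain ⟨ξ, hξ, h⟩ := mvt (s / 2) s (by linarith) (by linarith)
    have hξ0 : 0 < ξ := lt_trans (by linarith) hξ.1
    have h1 : S' s ≤ S' ξ := hanti hξ0 hs hξ.2.le
    have h2 : 0 ≤ S (s / 2) := hnonneg _ (show (0 : ℝ) ≤ s / 2 by linarith)
    rw [h, le_div_iff₀ (by linarith)] at h1
    linarith

/-- Pointwise bound for the derivative of `w ↦ (r₀ ∨ ‖w‖)^{-d} S((r₀ ∨ ‖w‖)^{-2})` off the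
sphere of radius `r₀`. -/
lemma norm_fderiv_radial_le {E : Type*} [NormedAddCommGroup E] [InnerProductSpace ℝ E]
    (d : ℕ) {r₀ : ℝ} (hr₀ : 0 < r₀) {S S' : ℝ → ℝ} (hmono : MonotoneOn S (Set.Ici 0))
    (hderiv : ∀ r ∈ Set.Ioi (0 : ℝ), HasDerivAt S (S' r) r)
    (hanti : AntitoneOn S' (Set.Ioi 0)) (hnonneg : ∀ r ∈ Set.Ici (0 : ℝ), 0 ≤ S r)
    {x : E} (hx : ‖x‖ ≠ r₀) :
    ‖fderiv ℝ (fun w : E =>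
        (max r₀ ‖w‖) ^ (-(d : ℝ)) * S ((max r₀ ‖w‖) ^ (-(2 : ℝ)))) x‖ ≤
      if r₀ < ‖x‖ then (d + 4) * ‖x‖ ^ (-((d : ℝ) + 1)) * S (r₀ ^ (-(2 : ℝ))) else 0 := by
  split_ifs with h
  · have hx0 : 0 < ‖x‖ := hr₀.trans h
    have hxne : x ≠ 0 := norm_pos_iff.mp hx0
    set t := ‖x‖ with ht
    have hs : 0 < t ^ (-(2 : ℝ)) := Real.rpow_pos_of_pos hx0 _
    have hφ : HasDerivAt (fun t : ℝ => t ^ (-(d : ℝ)) * S (t ^ (-(2 : ℝ))))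
        ((-(d : ℝ) * t ^ (-(d : ℝ) - 1)) * S (t ^ (-(2 : ℝ))) +
          t ^ (-(d : ℝ)) * (S' (t ^ (-(2 : ℝ))) * (-(2 : ℝ) * t ^ (-(2 : ℝ) - 1)))) t :=
      (Real.hasDerivAt_rpow_const (Or.inl hx0.ne')).mul
        ((hderiv _ hs).comp t (Real.hasDerivAt_rpow_const (Or.inl hx0.ne')))
    have hN : HasFDerivAt (fun w : E => ‖w‖) (fderiv ℝ (fun w : E => ‖w‖) x) x :=
      ((contDiffAt_norm ℝ hxne (n := 1)).differentiableAt (by simp)).hasFDerivAt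
    have hNle : ‖fderiv ℝ (fun w : E => ‖w‖) x‖ ≤ 1 := by
      simpa using norm_fderiv_le_of_lipschitz ℝ (lipschitzWith_one_norm (E := E)) (x₀ := x)
    have hcomp := HasDerivAt.comp_hasFDerivAt x hφ hN
    have heq : (fun w : E => (max r₀ ‖w‖) ^ (-(d : ℝ)) * S ((max r₀ ‖w‖) ^ (-(2 : ℝ))))
        =ᶠ[nhds x] (fun t : ℝ => t ^ (-(d : ℝ)) * S (t ^ (-(2 : ℝ)))) ∘ fun w : E => ‖w‖ := by
      filter_upwards [(continuous_norm.tendsto x).eventually_const_lt h] with w hw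
      simp [max_eq_right hw.le]
    rw [(hcomp.congr_of_eventuallyEq heq).fderiv, norm_smul]
    obtain ⟨h1, h2⟩ := deriv_nonneg_and_mul_deriv_le hmono hderiv hanti hnonneg hs
    have hS0 : 0 ≤ S (t ^ (-(2 : ℝ))) := hnonneg _ hs.le
    have hSle : S (t ^ (-(2 : ℝ))) ≤ S (r₀ ^ (-(2 : ℝ))) :=
      hmono hs.le (Real.rpow_pos_of_pos hr₀ _).le
        (Real.rpow_le_rpow_of_nonpos hr₀ h.le (by norm_num))
    have e1 : t ^ (-(d : ℝ) - 1) = t ^ (-((d : ℝ) + 1)) := by congr 1; ring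
    have e2 : t ^ (-(d : ℝ)) * t ^ (-(2 : ℝ) - 1) =
        t ^ (-((d : ℝ) + 1)) * t ^ (-(2 : ℝ)) := by
      rw [← Real.rpow_add hx0, ← Real.rpow_add hx0]; congr 1; ring
    have hp : 0 < t ^ (-((d : ℝ) + 1)) := Real.rpow_pos_of_pos hx0 _
    have e3 : (-(d : ℝ) * t ^ (-(d : ℝ) - 1)) * S (t ^ (-(2 : ℝ))) +
          t ^ (-(d : ℝ)) * (S' (t ^ (-(2 : ℝ))) * (-(2 : ℝ) * t ^ (-(2 : ℝ) - 1))) =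
        -(t ^ (-((d : ℝ) + 1)) * (d * S (t ^ (-(2 : ℝ))) +
          2 * (t ^ (-(2 : ℝ)) * S' (t ^ (-(2 : ℝ)))))) := by
      rw [e1]
      linear_combination (-2 * S' (t ^ (-(2 : ℝ)))) * e2
    rw [e3, norm_neg, Real.norm_of_nonneg (by positivity)]
    calc _ ≤ t ^ (-((d : ℝ) + 1)) * (d * S (t ^ (-(2 : ℝ))) +
          2 * (t ^ (-(2 : ℝ)) * S' (t ^ (-(2 : ℝ))))) * 1 := by gcongr
      _ ≤ t ^ (-((d : ℝ) + 1)) * (d * S (r₀ ^ (-(2 : ℝ))) +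
          2 * (2 * S (r₀ ^ (-(2 : ℝ))))) * 1 := by
        have h3 := h2.trans (mul_le_mul_of_nonneg_left hSle zero_le_two)
        gcongr ?_ * (_ * ?_ + 2 * ?_) * _
      _ = _ := by ring
  · have hlt : ‖x‖ < r₀ := lt_of_le_of_ne (not_lt.mp h) hx
    have heq : (fun w : E => (max r₀ ‖w‖) ^ (-(d : ℝ)) * S ((max r₀ ‖w‖) ^ (-(2 : ℝ))))
        =ᶠ[nhds x] fun _ => r₀ ^ (-(d : ℝ)) * S (r₀ ^ (-(2 : ℝ))) := by
      filter_upwards [(continuous_norm.tendsto x).eventually_lt_const hlt] with w hw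
      simp [max_eq_left hw.le]
    rw [heq.fderiv_eq]
    simp

lemma add_norm_rpow_smul {E : Type*} [NormedAddCommGroup E] [NormedSpace ℝ E] {r : ℝ}
    (hr : 0 < r) (p : ℝ) (z : E) :
    (r + ‖z‖) ^ p = r ^ p * (1 + ‖r⁻¹ • z‖) ^ p := by
  rw [← Real.mul_rpow hr.le (by positivity), norm_smul, Real.norm_of_nonneg (by positivity)]
  congr 1
  field_simp

/-- Integrability of the local supremum of the gradient of the auxiliary Lévy
density `ρ₀(z) = (r₀ ∨ |z|)^{-d} S((r₀ ∨ |z|)^{-2})`: there is a constant `c`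
depending only on `d` such that
`∫_{ℝ^d} sup_{|x-z| < r₀/2, |x| ≠ r₀} ‖∇ρ₀(x)‖ dz ≤ (c/r₀) S(r₀^{-2})`. -/
theorem auxiliary_density_gradient_sup_integral
    (d : ℕ) (hd : 1 ≤ d) :
    ∃ c ∈ Set.Ioi (0 : ℝ),
      ∀ r₀ : ℝ, 0 < r₀ →
      ∀ S S' : ℝ → ℝ,
        MonotoneOn S (Set.Ici 0) →
        (∀ r ∈ Set.Ioi (0 : ℝ), HasDerivAt S (S' r) r) →
        ContinuousOn S' (Set.Ioi 0) →
        AntitoneOn S' (Set.Ioi 0) →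
        S 0 = 0 →
        (∀ r ∈ Set.Ici (0 : ℝ), 0 ≤ S r) →
        (∫ z : EuclideanSpace ℝ (Fin d),
            sSup {q : ℝ | ∃ x : EuclideanSpace ℝ (Fin d),
              ‖x - z‖ < r₀ / 2 ∧ ‖x‖ ≠ r₀ ∧
              q = ‖fderiv ℝ
                    (fun w : EuclideanSpace ℝ (Fin d) =>
                      (max r₀ ‖w‖) ^ (-(d : ℝ)) * S ((max r₀ ‖w‖) ^ (-(2 : ℝ)))) x‖})
          ≤ (c / r₀) * S (r₀ ^ (-(2 : ℝ))) := by
  set I : ℝ := ∫ z : EuclideanSpace ℝ (Fin d), (1 + ‖z‖) ^ (-((d : ℝ) + 1)) with hI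
  have hI0 : 0 ≤ I := integral_nonneg fun z => by positivity
  have hint1 : Integrable fun z : EuclideanSpace ℝ (Fin d) => (1 + ‖z‖) ^ (-((d : ℝ) + 1)) :=
    integrable_one_add_norm (by simp)
  set K : ℝ := (d + 4) * (5 / 2) ^ ((d : ℝ) + 1) with hK
  have hK0 : 0 < K := by positivity
  refine ⟨K * I + 1, by simp only [Set.mem_Ioi]; positivity, ?_⟩
  intro r₀ hr₀ S S' hmono hderiv _ hanti _ hnonneg
  set A := S (r₀ ^ (-(2 : ℝ))) with hA
  have hA0 : 0 ≤ A := hnonneg _ (Real.rpow_pos_of_pos hr₀ _).le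
  have hint : Integrable fun z : EuclideanSpace ℝ (Fin d) =>
      (r₀ + ‖z‖) ^ (-((d : ℝ) + 1)) := by
    simp_rw [add_norm_rpow_smul hr₀]
    exact (hint1.comp_smul (inv_ne_zero hr₀.ne')).const_mul _
  have hval : ∫ z : EuclideanSpace ℝ (Fin d), (r₀ + ‖z‖) ^ (-((d : ℝ) + 1)) = r₀⁻¹ * I := by
    simp_rw [add_norm_rpow_smul hr₀]
    rw [integral_const_mul, Measure.integral_comp_inv_smul_of_nonneg volume
      (fun z : EuclideanSpace ℝ (Fin d) => (1 + ‖z‖) ^ (-((d : ℝ) + 1))) hr₀.le,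
      smul_eq_mul, finrank_euclideanSpace_fin, ← mul_assoc, ← Real.rpow_natCast,
      ← Real.rpow_add hr₀, ← hI, ← Real.rpow_neg_one r₀]
    congr 2
    ring
  calc _ ≤ ∫ z : EuclideanSpace ℝ (Fin d), K * A * (r₀ + ‖z‖) ^ (-((d : ℝ) + 1)) := by
        refine integral_mono_of_nonneg (Filter.Eventually.of_forall fun z => ?_)
          (hint.const_mul _) (Filter.Eventually.of_forall fun z => ?_)
        · refine Real.sSup_nonneg ?_
          rintro q ⟨x, -, -, rfl⟩
          exact norm_nonneg _
        · have hb : 0 ≤ K * A * (r₀ + ‖z‖) ^ (-((d : ℝ) + 1)) := by positivity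
          refine Real.sSup_le ?_ hb
          rintro q ⟨x, hxz, hx, rfl⟩
          refine (norm_fderiv_radial_le d hr₀ hmono hderiv hanti hnonneg hx).trans ?_
          split_ifs with h
          · have hz : r₀ + ‖z‖ ≤ 5 / 2 * ‖x‖ := by
              have := norm_sub_norm_le z x
              rw [norm_sub_rev] at this
              linarith
            have hle : (5 / 2 * ‖x‖) ^ (-((d : ℝ) + 1)) ≤ (r₀ + ‖z‖) ^ (-((d : ℝ) + 1)) :=
              Real.rpow_le_rpow_of_nonpos (by positivity) hz
                (by have : (0 : ℝ) ≤ d := d.cast_nonneg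
                    linarith)
            have hfac : ‖x‖ ^ (-((d : ℝ) + 1)) =
                (5 / 2) ^ ((d : ℝ) + 1) * (5 / 2 * ‖x‖) ^ (-((d : ℝ) + 1)) := by
              rw [Real.mul_rpow (by norm_num) (norm_nonneg x), ← mul_assoc,
                ← Real.rpow_add (by norm_num), add_neg_cancel, Real.rpow_zero, one_mul]
            rw [hfac]
            calc _ = K * A * (5 / 2 * ‖x‖) ^ (-((d : ℝ) + 1)) := by rw [hK, hA]; ring
              _ ≤ _ := mul_le_mul_of_nonneg_left hle (by positivity)
          · exact hb
    _ = K * A * (r₀⁻¹ * I) := by rw [integral_const_mul, hval]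
    _ ≤ (K * I + 1) / r₀ * A := by
        have : 0 ≤ r₀⁻¹ * A := by positivity
        rw [div_eq_mul_inv]
        linarith
end
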